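/- For every θ ∈ {−1, 0, 1}, admissible fugacity z, T > 0, ĉ > 0, u ∈ ℝ³, every symmetric traceless real 3×3 matrix σ = (σ_{ij}) and every q ∈ ℝ³, the closing moments of the quantum Grad 13-moment ansatz are given by q_{ijk} := ĉ∫_{ℝ³} f_{G13}·c_i c_j c_k dv = (2/5)(δ_{ij}q_k + δ_{ik}q_j + δ_{kj}q_i) for all i, j, k, and Δ_{ij} := ĉ∫_{ℝ³} f_{G13}·c_i c_j |c|² dv = ĉ(2πT)^{3/2}·T²·𝓛₇·(5δ_{ij} + 7(σ_{ij}/p)·𝓛₅𝓛₉/𝓛₇²) for all i, j. -/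

import Mathlib

open Real MeasureTheory Matrix

/-- The quantum polylogarithm `𝓛_s(z)`. -/
noncomputable def qpolylog (θ s z : ℝ) : ℝ :=
  (1 / Real.Gamma s) * ∫ t in Set.Ioi (0:ℝ), t ^ (s - 1) / (z⁻¹ * Real.exp t + θ)

/-- Admissible fugacity: `z > 0`, and additionally `z < 1` for Bosons (`θ = -1`). -/
def admissible (θ z : ℝ) : Prop := 0 < z ∧ (θ = -1 → z < 1)

/-- Pressure `p = ĉ(2πT)^{3/2}T𝓛₅`. -/
noncomputable def qpressure (θ z T c : ℝ) : ℝ :=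
  c * (2 * Real.pi * T) ^ ((3:ℝ)/2) * T * qpolylog θ (5/2) z

/-- The quantum Grad 13-moment ansatz `f_{G13}`. -/
noncomputable def fG13 (θ z T c : ℝ) (u : EuclideanSpace ℝ (Fin 3))
    (σ : Matrix (Fin 3) (Fin 3) ℝ) (q : Fin 3 → ℝ)
    (v : EuclideanSpace ℝ (Fin 3)) : ℝ :=
  let L3 := qpolylog θ (3/2) z
  let L5 := qpolylog θ (5/2) z
  let L7 := qpolylog θ (7/2) z
  let L9 := qpolylog θ (9/2) z
  let p := qpressure θ z T c
  let B := (7/2) * L9 / L5 - (5/2) * L7^2 / L5^2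
  (z⁻¹ * Real.exp (‖v - u‖^2 / (2*T)) + θ)⁻¹ *
    (1 + (∑ i, ∑ j, (σ i j / (2 * p)) * (L5 / L7) *
            ((v i - u i) * (v j - u j) / T - (if i = j then (1:ℝ) else 0) * (L5 / L3)))
      + ∑ i, (B⁻¹ * q i / (5 * p * T)) * (v i - u i) * (‖v - u‖^2 / T - 5 * L7 / L5))

/-- The equilibrium occupation number `(z⁻¹eᵗ + θ)⁻¹` as a function of the reduced energy `t`. -/
noncomputable def occupation (θ z t : ℝ) : ℝ := (z⁻¹ * Real.exp t + θ)⁻¹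

lemma measurable_occupation (θ z : ℝ) : Measurable (occupation θ z) := by
  unfold occupation; fun_prop

/-- The denominator of the occupation number is bounded below by a multiple of the Maxwellian. -/
lemma admissible.exists_mul_exp_le {θ z : ℝ} (hθ : θ = -1 ∨ θ = 0 ∨ θ = 1)
    (hz : admissible θ z) :
    ∃ κ > 0, ∀ t ≥ 0, κ * Real.exp t ≤ z⁻¹ * Real.exp t + θ := by
  obtain ⟨hz0, hz1⟩ := hz
  rcases hθ with rfl | h
  · refine ⟨z⁻¹ - 1, sub_pos.2 ((one_lt_inv₀ hz0).2 (hz1 rfl)), fun t ht => ?_⟩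
    have := Real.one_le_exp ht
    linarith
  · refine ⟨z⁻¹, inv_pos.2 hz0, fun t _ => ?_⟩
    rcases h with rfl | rfl <;> linarith

lemma admissible.occupation_pos {θ z : ℝ} (hθ : θ = -1 ∨ θ = 0 ∨ θ = 1)
    (hz : admissible θ z) {t : ℝ} (ht : 0 ≤ t) : 0 < occupation θ z t := by
  obtain ⟨κ, hκ, h⟩ := hz.exists_mul_exp_le hθ
  exact inv_pos.2 (lt_of_lt_of_le (by positivity) (h t ht))

lemma admissible.exists_occupation_le {θ z : ℝ} (hθ : θ = -1 ∨ θ = 0 ∨ θ = 1)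
    (hz : admissible θ z) : ∃ C > 0, ∀ t ≥ 0, occupation θ z t ≤ C * Real.exp (-t) := by
  obtain ⟨κ, hκ, h⟩ := hz.exists_mul_exp_le hθ
  refine ⟨κ⁻¹, inv_pos.2 hκ, fun t ht => ?_⟩
  rw [Real.exp_neg, ← mul_inv]
  exact inv_anti₀ (by positivity) (h t ht)

lemma integrableOn_rpow_mul_occupation {θ z s : ℝ} (hθ : θ = -1 ∨ θ = 0 ∨ θ = 1)
    (hz : admissible θ z) (hs : 0 < s) :
    IntegrableOn (fun t => t ^ (s - 1) * occupation θ z t) (Set.Ioi 0) := by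
  obtain ⟨C, hC, h⟩ := hz.exists_occupation_le hθ
  refine Integrable.mono' ((Real.GammaIntegral_convergent hs).const_mul C) ?_ ?_
  · exact ((measurable_id.pow_const _).mul (measurable_occupation θ z)).aestronglyMeasurable
  · filter_upwards [ae_restrict_mem measurableSet_Ioi] with t (ht : 0 < t)
    have hw := hz.occupation_pos hθ ht.le
    rw [Real.norm_of_nonneg (by positivity)]
    calc t ^ (s - 1) * occupation θ z t ≤ t ^ (s - 1) * (C * Real.exp (-t)) := by
          gcongr; exact h t ht.le
      _ = _ := by ring

lemma integral_rpow_mul_occupation (θ z : ℝ) {s : ℝ} (hs : 0 < s) :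
    ∫ t in Set.Ioi (0:ℝ), t ^ (s - 1) * occupation θ z t = Real.Gamma s * qpolylog θ s z := by
  have := (Real.Gamma_pos_of_pos hs).ne'
  simp only [qpolylog, occupation, div_eq_mul_inv]
  field_simp

lemma qpolylog_pos {θ z s : ℝ} (hθ : θ = -1 ∨ θ = 0 ∨ θ = 1)
    (hz : admissible θ z) (hs : 0 < s) : 0 < qpolylog θ s z := by
  have hΓ := Real.Gamma_pos_of_pos hs
  rw [← mul_pos_iff_of_pos_left hΓ, ← integral_rpow_mul_occupation θ z hs, setIntegral_pos_iff_support_of_nonneg_ae ?_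
    (integrableOn_rpow_mul_occupation hθ hz hs)]
  · refine lt_of_lt_of_le (?_ : 0 < volume (Set.Ioi (0:ℝ))) (measure_mono fun t ht => ⟨?_, ht⟩)
    · simp
    · exact (mul_pos (Real.rpow_pos_of_pos ht _) (hz.occupation_pos hθ (le_of_lt ht))).ne'
  · filter_upwards [ae_restrict_mem measurableSet_Ioi] with t (ht : 0 < t)
    exact (mul_pos (Real.rpow_pos_of_pos ht _) (hz.occupation_pos hθ ht.le)).le

/-- Strict log-convexity of the moments of the occupation number, by Cauchy–Schwarz. -/
lemma qpolylog_sq_lt {θ z s : ℝ} (hθ : θ = -1 ∨ θ = 0 ∨ θ = 1)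
    (hz : admissible θ z) (hs : 0 < s) :
    s * qpolylog θ (s + 1) z ^ 2 < (s + 1) * (qpolylog θ s z * qpolylog θ (s + 2) z) := by
  have hΓ := Real.Gamma_pos_of_pos hs
  have hL := qpolylog_pos hθ hz hs
  set l : ℝ := s * qpolylog θ (s + 1) z / qpolylog θ s z with hl
  have h0 := integrableOn_rpow_mul_occupation hθ hz hs
  have h1 := integrableOn_rpow_mul_occupation hθ hz (by linarith : 0 < s + 1)
  have h2 := integrableOn_rpow_mul_occupation hθ hz (by linarith : 0 < s + 2)
  have hEq : Set.EqOn (fun t => t ^ (s - 1) * occupation θ z t * (t - l) ^ 2)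
      (fun t => t ^ (s + 2 - 1) * occupation θ z t
        - 2 * l * (t ^ (s + 1 - 1) * occupation θ z t)
        + l ^ 2 * (t ^ (s - 1) * occupation θ z t)) (Set.Ioi 0) := by
    intro t (ht : 0 < t)
    have e1 : t ^ (s + 1 - 1) = t ^ (s - 1) * t := by
      rw [← Real.rpow_add_one ht.ne']; ring_nf
    have e2 : t ^ (s + 2 - 1) = t ^ (s - 1) * t * t := by
      rw [← Real.rpow_add_one ht.ne', ← Real.rpow_add_one ht.ne']; ring_nf
    simp only [e1, e2]
    ring
  have h21 : IntegrableOn (fun t => t ^ (s + 2 - 1) * occupation θ z t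
      - 2 * l * (t ^ (s + 1 - 1) * occupation θ z t)) (Set.Ioi 0) := h2.sub (h1.const_mul (2 * l))
  have hint : IntegrableOn (fun t => t ^ (s - 1) * occupation θ z t * (t - l) ^ 2)
      (Set.Ioi 0) :=
    IntegrableOn.congr_fun (h21.add (h0.const_mul (l ^ 2)))
      hEq.symm measurableSet_Ioi
  have hval : ∫ t in Set.Ioi (0:ℝ), t ^ (s - 1) * occupation θ z t * (t - l) ^ 2 =
      Real.Gamma (s + 2) * qpolylog θ (s + 2) z
        - 2 * l * (Real.Gamma (s + 1) * qpolylog θ (s + 1) z)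
        + l ^ 2 * (Real.Gamma s * qpolylog θ s z) := by
    rw [setIntegral_congr_fun measurableSet_Ioi hEq,
      integral_add h21 (h0.const_mul (l ^ 2)),
      integral_sub h2 (h1.const_mul (2 * l)), integral_const_mul, integral_const_mul,
      integral_rpow_mul_occupation θ z hs,
      integral_rpow_mul_occupation θ z (by linarith : 0 < s + 1),
      integral_rpow_mul_occupation θ z (by linarith : 0 < s + 2)]
  have hpos : 0 < ∫ t in Set.Ioi (0:ℝ), t ^ (s - 1) * occupation θ z t * (t - l) ^ 2 := by
    rw [setIntegral_pos_iff_support_of_nonneg_ae ?_ hint]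
    · refine lt_of_lt_of_le (?_ : 0 < volume (Set.Ioi (max 0 l)))
        (measure_mono fun t ht => ?_)
      · simp
      · obtain ⟨ht0, htl⟩ := max_lt_iff.1 (Set.mem_Ioi.1 ht)
        exact ⟨(mul_pos (mul_pos (Real.rpow_pos_of_pos ht0 _) (hz.occupation_pos hθ ht0.le))
          (pow_pos (sub_pos.2 htl) 2)).ne', ht0⟩
    · filter_upwards [ae_restrict_mem measurableSet_Ioi] with t (ht : 0 < t)
      exact mul_nonneg (mul_pos (Real.rpow_pos_of_pos ht _) (hz.occupation_pos hθ ht.le)).le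
        (sq_nonneg _)
  have g1 : Real.Gamma (s + 1) = s * Real.Gamma s := Real.Gamma_add_one hs.ne'
  have g2 : Real.Gamma (s + 2) = (s + 1) * (s * Real.Gamma s) := by
    rw [← g1, ← Real.Gamma_add_one (by linarith)]; ring_nf
  rw [hval, g1, g2] at hpos
  have key : (s + 1) * (s * Real.Gamma s) * qpolylog θ (s + 2) z
        - 2 * l * (s * Real.Gamma s * qpolylog θ (s + 1) z)
        + l ^ 2 * (Real.Gamma s * qpolylog θ s z) =
      s * Real.Gamma s / qpolylog θ s z *
        ((s + 1) * (qpolylog θ s z * qpolylog θ (s + 2) z) - s * qpolylog θ (s + 1) z ^ 2) := by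
    rw [hl]; field_simp; ring
  rw [key] at hpos
  exact sub_pos.1 (pos_of_mul_pos_right hpos (by positivity))

lemma integrable_occupation_mul_norm_pow {θ z T : ℝ} (hθ : θ = -1 ∨ θ = 0 ∨ θ = 1)
    (hz : admissible θ z) (hT : 0 < T) (n : ℕ) :
    Integrable (fun x : EuclideanSpace ℝ (Fin 3) =>
      occupation θ z (‖x‖ ^ 2 / (2 * T)) * ‖x‖ ^ n) := by
  rw [integrable_fun_norm_addHaar volume (f := fun r => occupation θ z (r ^ 2 / (2 * T)) * r ^ n)]
  obtain ⟨C, hC, h⟩ := hz.exists_occupation_le hθ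
  have hg := (integrableOn_rpow_mul_exp_neg_mul_sq (b := (2 * T)⁻¹) (by positivity)
    (s := ((n + 2 : ℕ) : ℝ)) (by linarith [(n + 2).cast_nonneg (α := ℝ)])).const_mul C
  refine Integrable.mono' hg ?_ ?_
  · have := measurable_occupation θ z
    exact Measurable.aestronglyMeasurable (by fun_prop)
  · filter_upwards [ae_restrict_mem measurableSet_Ioi] with r (hr : 0 < r)
    have hw := hz.occupation_pos hθ (by positivity : 0 ≤ r ^ 2 / (2 * T))
    simp only [finrank_euclideanSpace, Fintype.card_fin, smul_eq_mul]
    rw [Real.norm_of_nonneg (by positivity), Real.rpow_natCast]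
    calc r ^ (3 - 1) * (occupation θ z (r ^ 2 / (2 * T)) * r ^ n)
        ≤ r ^ (3 - 1) * (C * Real.exp (-(r ^ 2 / (2 * T))) * r ^ n) := by
          gcongr; exact h _ (by positivity)
      _ = C * (r ^ (n + 2) * Real.exp (-(2 * T)⁻¹ * r ^ 2)) := by ring_nf

lemma integral_occupation_mul_norm_pow (θ z : ℝ) {T : ℝ} (hT : 0 < T) (m : ℕ) :
    ∫ x : EuclideanSpace ℝ (Fin 3), occupation θ z (‖x‖ ^ 2 / (2 * T)) * ‖x‖ ^ (2 * m) =
      2 * π * (2 * T) ^ ((m : ℝ) + 3 / 2) *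
        (Real.Gamma (m + 3 / 2) * qpolylog θ (m + 3 / 2) z) := by
  rw [integral_fun_norm_addHaar volume
    (fun r => occupation θ z (r ^ 2 / (2 * T)) * r ^ (2 * m)),
    ← integral_rpow_mul_occupation θ z (by positivity)]
  have hball : (volume : Measure (EuclideanSpace ℝ (Fin 3))).real (Metric.ball 0 1)
      = π * 4 / 3 := by
    simp [measureReal_def, EuclideanSpace.volume_ball_fin_three]
    positivity
  set F : ℝ → ℝ := fun t => t ^ ((m : ℝ) + 3 / 2 - 1) * occupation θ z t with hF
  have hscale := integral_comp_mul_left_Ioi F 0 (b := (2 * T)⁻¹) (by positivity)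
  have hsq := integral_comp_rpow_Ioi_of_pos (g := fun t => F ((2 * T)⁻¹ * t)) (p := 2) two_pos
  rw [mul_zero, inv_inv, smul_eq_mul] at hscale
  rw [hscale] at hsq
  have h2T : (2 * T) ^ ((m : ℝ) + 3 / 2) = (2 * T) ^ ((m : ℝ) + 3 / 2 - 1) * (2 * T) := by
    rw [← Real.rpow_add_one (by positivity)]; ring_nf
  have hEq : ∫ y in Set.Ioi (0:ℝ), y ^ (Module.finrank ℝ (EuclideanSpace ℝ (Fin 3)) - 1) •
      (occupation θ z (y ^ 2 / (2 * T)) * y ^ (2 * m)) =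
      ∫ y in Set.Ioi (0:ℝ), (2 * T) ^ ((m : ℝ) + 3 / 2 - 1) / 2 *
        ((2 * y ^ ((2:ℝ) - 1)) • F ((2 * T)⁻¹ * y ^ (2:ℝ))) := by
    refine setIntegral_congr_fun measurableSet_Ioi fun y (hy : 0 < y) => ?_
    have e : y ^ (2 : ℝ) = y ^ 2 := by exact_mod_cast Real.rpow_natCast y 2
    have e1 : y ^ ((2 : ℝ) - 1) = y := by norm_num
    have e2 : (y ^ 2) ^ ((m : ℝ) + 3 / 2 - 1) = y ^ (2 * m + 1) := by
      rw [← e, ← Real.rpow_mul hy.le, ← Real.rpow_natCast]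
      push_cast; ring_nf
    have hp : (2 * T) ^ ((m : ℝ) + 3 / 2 - 1) ≠ 0 := by positivity
    simp only [hF, finrank_euclideanSpace, Fintype.card_fin, smul_eq_mul]
    rw [e, e1, Real.mul_rpow (x := (2 * T)⁻¹) (by positivity) (by positivity), Real.inv_rpow (by positivity), e2,
      inv_mul_eq_div]
    field_simp
    ring
  rw [hEq, integral_const_mul, hsq, hball, h2T]
  simp only [finrank_euclideanSpace, Fintype.card_fin, smul_eq_mul, nsmul_eq_mul]
  push_cast
  ring

section Isotropy

variable {ι : Type*} [Fintype ι] {g : ℝ → ℝ}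

/-- Directional moments of a radial function only depend on the length of the direction. -/
lemma integral_radial_mul_inner_pow_eq {E : Type*} [NormedAddCommGroup E]
    [InnerProductSpace ℝ E] [FiniteDimensional ℝ E] [MeasurableSpace E] [BorelSpace E]
    (g : ℝ → ℝ) (n : ℕ) {a b : E} (hab : ‖a‖ = ‖b‖) :
    ∫ x : E, g ‖x‖ * inner ℝ a x ^ n = ∫ x : E, g ‖x‖ * inner ℝ b x ^ n := by
  let R := (ℝ ∙ (a - b))ᗮ.reflection
  have hR : R a = b := Submodule.reflection_sub hab
  have hmp : MeasurePreserving R := R.measurePreserving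
  symm
  rw [← hmp.integral_comp R.toHomeomorph.measurableEmbedding]
  simp only [R.norm_map, ← hR, R.inner_map_map]

lemma integral_radial_mul_inner_pow {E : Type*} [NormedAddCommGroup E]
    [InnerProductSpace ℝ E] [FiniteDimensional ℝ E] [MeasurableSpace E] [BorelSpace E]
    (g : ℝ → ℝ) (n : ℕ) (a : E) {e : E} (he : ‖e‖ = 1) :
    ∫ x : E, g ‖x‖ * inner ℝ a x ^ n = ‖a‖ ^ n * ∫ x : E, g ‖x‖ * inner ℝ e x ^ n := by
  rw [integral_radial_mul_inner_pow_eq g n (a := a) (b := ‖a‖ • e) (by simp [norm_smul, he]),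
    ← integral_const_mul]
  congr with x
  rw [real_inner_smul_left]
  ring

lemma integrable_radial_mul {f : EuclideanSpace ℝ ι → ℝ} {n : ℕ}
    (hg : Integrable (fun x : EuclideanSpace ℝ ι => g ‖x‖ * ‖x‖ ^ n))
    (hgm : Measurable g) (hf : Measurable f) {C : ℝ} (hle : ∀ x, |f x| ≤ C * ‖x‖ ^ n) :
    Integrable (fun x : EuclideanSpace ℝ ι => g ‖x‖ * f x) := by
  refine Integrable.mono' (hg.norm.const_mul C) ?_ (.of_forall fun x => ?_)
  · exact Measurable.aestronglyMeasurable (by fun_prop)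
  · simp only [norm_mul, Real.norm_eq_abs, abs_pow, abs_norm]
    calc |g ‖x‖| * |f x| ≤ |g ‖x‖| * (C * ‖x‖ ^ n) := by gcongr; exact hle x
      _ = _ := by ring

lemma EuclideanSpace.abs_apply_le_norm (x : EuclideanSpace ℝ ι) (i : ι) : |x i| ≤ ‖x‖ :=
  PiLp.norm_apply_le x i

lemma integrable_radial_mul_four
    (hg : Integrable (fun x : EuclideanSpace ℝ ι => g ‖x‖ * ‖x‖ ^ 4))
    (hgm : Measurable g) (i j k l : ι) :
    Integrable (fun x : EuclideanSpace ℝ ι => g ‖x‖ * (x i * x j * x k * x l)) := by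
  refine integrable_radial_mul hg hgm (by fun_prop) (C := 1) fun x => ?_
  have h := EuclideanSpace.abs_apply_le_norm x
  rw [abs_mul, abs_mul, abs_mul]
  calc |x i| * |x j| * |x k| * |x l| ≤ ‖x‖ * ‖x‖ * ‖x‖ * ‖x‖ := by gcongr <;> apply h
    _ = 1 * ‖x‖ ^ 4 := by ring

lemma integral_radial_mul_four_of_unit [DecidableEq ι]
    (hg : Integrable (fun x : EuclideanSpace ℝ ι => g ‖x‖ * ‖x‖ ^ 4))
    (hgm : Measurable g) {e : EuclideanSpace ℝ ι} (he : ‖e‖ = 1) (i j k l : ι) :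
    ∫ x : EuclideanSpace ℝ ι, g ‖x‖ * (x i * x j * x k * x l) =
      ((if i = j then (1:ℝ) else 0) * (if k = l then (1:ℝ) else 0)
        + (if i = k then (1:ℝ) else 0) * (if j = l then (1:ℝ) else 0)
        + (if i = l then (1:ℝ) else 0) * (if j = k then (1:ℝ) else 0)) / 3 *
        ∫ x : EuclideanSpace ℝ ι, g ‖x‖ * inner ℝ e x ^ 4 := by
  let s : Fin 2 → ℝ := ![1, -1]
  let b : ι → EuclideanSpace ℝ ι := fun i => EuclideanSpace.single i 1
  let a : Fin 2 × Fin 2 × Fin 2 → EuclideanSpace ℝ ι := fun r =>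
    s r.1 • b i + s r.2.1 • b j + s r.2.2 • b k + b l
  have hb (i j : ι) : inner ℝ (b i) (b j) = if i = j then (1:ℝ) else 0 := by
    simp [b, EuclideanSpace.inner_single_left, PiLp.single_apply]
  have hx (x : EuclideanSpace ℝ ι) (i : ι) : inner ℝ (b i) x = x i := by
    simp [b, EuclideanSpace.inner_single_left]
  have hpol (x : EuclideanSpace ℝ ι) : g ‖x‖ * (x i * x j * x k * x l) =
      ∑ r, s r.1 * s r.2.1 * s r.2.2 / 192 * (g ‖x‖ * inner ℝ (a r) x ^ 4) := by
    simp only [Fintype.sum_prod_type, Fin.sum_univ_two, a, s, inner_add_left,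
      real_inner_smul_left, hx, Matrix.cons_val_zero, Matrix.cons_val_one]
    ring
  have hnorm (r) : ‖a r‖ ^ 4 = inner ℝ (a r) (a r) ^ 2 := by
    rw [real_inner_self_eq_norm_sq]; ring
  have hint (a : EuclideanSpace ℝ ι) :
      Integrable (fun x : EuclideanSpace ℝ ι => g ‖x‖ * inner ℝ a x ^ 4) := by
    refine integrable_radial_mul hg hgm (by fun_prop) (C := ‖a‖ ^ 4) fun x => ?_
    rw [abs_pow, ← mul_pow]
    gcongr
    exact abs_real_inner_le_norm a x
  simp_rw [hpol]
  rw [integral_finsetSum _ fun r _ => (hint (a r)).const_mul _]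
  simp_rw [integral_const_mul, integral_radial_mul_inner_pow g 4 (a _) he, hnorm]
  simp only [Fintype.sum_prod_type, Fin.sum_univ_two, a, s, inner_add_left, inner_add_right,
      real_inner_smul_left, real_inner_smul_right, hb, Matrix.cons_val_zero, Matrix.cons_val_one,
      eq_comm (a := j) (b := i), eq_comm (a := k) (b := i), eq_comm (a := l) (b := i),
      eq_comm (a := k) (b := j), eq_comm (a := l) (b := j), eq_comm (a := l) (b := k), if_true]
  ring

/-- The fourth moments of a radial function form an isotropic tensor. -/
lemma integral_radial_mul_four [DecidableEq ι] [Nonempty ι]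
    (hg : Integrable (fun x : EuclideanSpace ℝ ι => g ‖x‖ * ‖x‖ ^ 4))
    (hgm : Measurable g) (i j k l : ι) :
    ∫ x : EuclideanSpace ℝ ι, g ‖x‖ * (x i * x j * x k * x l) =
      ((if i = j then (1:ℝ) else 0) * (if k = l then (1:ℝ) else 0)
        + (if i = k then (1:ℝ) else 0) * (if j = l then (1:ℝ) else 0)
        + (if i = l then (1:ℝ) else 0) * (if j = k then (1:ℝ) else 0)) /
        (Fintype.card ι * (Fintype.card ι + 2)) *
        ∫ x : EuclideanSpace ℝ ι, g ‖x‖ * ‖x‖ ^ 4 := by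
  have he : ‖EuclideanSpace.single (Classical.arbitrary ι) (1:ℝ)‖ = 1 := by simp
  have htrace : ∫ x : EuclideanSpace ℝ ι, g ‖x‖ * ‖x‖ ^ 4 =
      ∑ m : ι, ∑ n : ι, ∫ x : EuclideanSpace ℝ ι, g ‖x‖ * (x m * x m * x n * x n) := by
    simp_rw [← integral_finsetSum _ fun n _ => integrable_radial_mul_four hg hgm _ _ n n]
    rw [← integral_finsetSum _ fun m _ =>
      integrable_finsetSum _ fun n _ => integrable_radial_mul_four hg hgm m m n n]
    congr with x
    rw [show ‖x‖ ^ 4 = ‖x‖ ^ 2 * ‖x‖ ^ 2 by ring, EuclideanSpace.real_norm_sq_eq,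
      Finset.sum_mul_sum, Finset.mul_sum]
    refine Finset.sum_congr rfl fun m _ => ?_
    rw [Finset.mul_sum]
    exact Finset.sum_congr rfl fun n _ => by ring
  have hcard : (Fintype.card ι : ℝ) ≠ 0 := by simp
  have hcard2 : (Fintype.card ι : ℝ) + 2 ≠ 0 := by positivity
  simp_rw [integral_radial_mul_four_of_unit hg hgm he] at htrace ⊢
  simp only [← Finset.sum_mul, ← Finset.sum_div, Finset.sum_add_distrib] at htrace
  simp only [if_true, mul_one, Finset.sum_const, Finset.card_univ, nsmul_eq_mul, mul_ite,
    mul_zero, Finset.sum_ite_eq, Finset.mem_univ] at htrace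
  rw [htrace]
  field_simp
  ring

/-- Contraction of `integral_radial_mul_four` in one pair of indices. -/
lemma integral_radial_mul_sq_norm_mul_two [DecidableEq ι] [Nonempty ι]
    (hg : Integrable (fun x : EuclideanSpace ℝ ι => g ‖x‖ * ‖x‖ ^ 4))
    (hgm : Measurable g) (i j : ι) :
    ∫ x : EuclideanSpace ℝ ι, g ‖x‖ * (x i * x j * ‖x‖ ^ 2) =
      (if i = j then (1:ℝ) else 0) / Fintype.card ι *
        ∫ x : EuclideanSpace ℝ ι, g ‖x‖ * ‖x‖ ^ 4 := by
  have hsum (x : EuclideanSpace ℝ ι) : g ‖x‖ * (x i * x j * ‖x‖ ^ 2) =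
      ∑ k, g ‖x‖ * (x i * x j * x k * x k) := by
    rw [EuclideanSpace.real_norm_sq_eq, Finset.mul_sum, Finset.mul_sum]
    exact Finset.sum_congr rfl fun k _ => by ring
  have hcard : (Fintype.card ι : ℝ) ≠ 0 := by simp
  have hcard2 : (Fintype.card ι : ℝ) + 2 ≠ 0 := by positivity
  simp_rw [hsum]
  rw [integral_finsetSum _ fun k _ => integrable_radial_mul_four hg hgm i j k k]
  simp_rw [integral_radial_mul_four hg hgm]
  simp only [← Finset.sum_mul, ← Finset.sum_div, Finset.sum_add_distrib]
  simp only [if_true, mul_one, Finset.sum_const, Finset.card_univ, nsmul_eq_mul, mul_ite,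
    mul_zero, Finset.sum_ite_eq, Finset.mem_univ]
  field_simp
  split_ifs <;> ring

end Isotropy

lemma integral_eq_zero_of_odd {E : Type*} [NormedAddCommGroup E] [MeasurableSpace E]
    [BorelSpace E] {μ : Measure E} [μ.IsNegInvariant] {f : E → ℝ} (hf : ∀ x, f (-x) = -f x) :
    ∫ x, f x ∂μ = 0 := by
  have h := integral_neg_eq_self f μ
  simp_rw [hf, integral_neg] at h
  linarith

lemma EuclideanSpace.hasTemperateGrowth_apply {ι : Type*} [Fintype ι] (i : ι) :
    Function.HasTemperateGrowth (fun x : EuclideanSpace ℝ ι => x i) :=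
  (EuclideanSpace.proj (𝕜 := ℝ) i : EuclideanSpace ℝ ι →L[ℝ] ℝ).hasTemperateGrowth

lemma integrable_occupation_mul {θ z T : ℝ} (hθ : θ = -1 ∨ θ = 0 ∨ θ = 1)
    (hz : admissible θ z) (hT : 0 < T) {f : EuclideanSpace ℝ (Fin 3) → ℝ}
    (hf : f.HasTemperateGrowth) :
    Integrable (fun x => occupation θ z (‖x‖ ^ 2 / (2 * T)) * f x) := by
  obtain ⟨k, C, hC⟩ := hf.2 0
  have hw (x : EuclideanSpace ℝ (Fin 3)) := hz.occupation_pos hθ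
    (by positivity : 0 ≤ ‖x‖ ^ 2 / (2 * T))
  have hint : Integrable (fun x : EuclideanSpace ℝ (Fin 3) =>
      C * (occupation θ z (‖x‖ ^ 2 / (2 * T)) * (1 + ‖x‖) ^ k)) := by
    simp_rw [add_comm (1 : ℝ), add_pow, one_pow, mul_one, Finset.mul_sum]
    refine integrable_finsetSum _ fun m _ => Integrable.const_mul ?_ C
    simpa only [mul_assoc] using
      (integrable_occupation_mul_norm_pow hθ hz hT m).mul_const ((k.choose m : ℕ) : ℝ)
  refine hint.mono' ?_ (.of_forall fun x => ?_)
  · have := measurable_occupation θ z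
    have := hf.1.continuous.measurable
    exact Measurable.aestronglyMeasurable (by fun_prop)
  · have := hC x
    rw [norm_iteratedFDeriv_zero] at this
    rw [norm_mul, Real.norm_of_nonneg (hw x).le]
    calc _ ≤ occupation θ z (‖x‖ ^ 2 / (2 * T)) * (C * (1 + ‖x‖) ^ k) :=
          mul_le_mul_of_nonneg_left this (hw x).le
      _ = _ := by ring

/-- The deviation of the 13-moment ansatz from equilibrium, as a polynomial in the peculiar
velocity, with stress coefficients `A` and heat-flux coefficients `b`. -/
noncomputable def gradFactor (T D E : ℝ) (A : Matrix (Fin 3) (Fin 3) ℝ) (b : Fin 3 → ℝ)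
    (x : EuclideanSpace ℝ (Fin 3)) : ℝ :=
  1 + (∑ i, ∑ j, A i j * (x i * x j / T - (if i = j then (1:ℝ) else 0) * D))
    + ∑ i, b i * x i * (‖x‖ ^ 2 / T - E)

lemma gradFactor_eq_of_trace_eq_zero {T D E : ℝ} {A : Matrix (Fin 3) (Fin 3) ℝ} (hA : A.trace = 0)
    (b : Fin 3 → ℝ) (x : EuclideanSpace ℝ (Fin 3)) :
    gradFactor T D E A b x =
      1 + (∑ i, ∑ j, A i j / T * (x i * x j)) + ∑ i, b i * (x i * (‖x‖ ^ 2 / T - E)) := by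
  simp only [Matrix.trace_fin_three] at hA
  simp only [gradFactor, Fin.sum_univ_three, Fin.isValue, Fin.reduceEq, if_true, if_false]
  linear_combination -D * hA

lemma integral_gradFactor_mul_three {θ z T : ℝ} (hθ : θ = -1 ∨ θ = 0 ∨ θ = 1)
    (hz : admissible θ z) (hT : 0 < T) (D E : ℝ) {A : Matrix (Fin 3) (Fin 3) ℝ}
    (hA : A.trace = 0) (b : Fin 3 → ℝ) (i j k : Fin 3) :
    ∫ x : EuclideanSpace ℝ (Fin 3),
        occupation θ z (‖x‖ ^ 2 / (2 * T)) * gradFactor T D E A b x * x i * x j * x k =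
      ((∫ x : EuclideanSpace ℝ (Fin 3), occupation θ z (‖x‖ ^ 2 / (2 * T)) * ‖x‖ ^ (2 * 3)) / T
        - E * ∫ x : EuclideanSpace ℝ (Fin 3), occupation θ z (‖x‖ ^ 2 / (2 * T)) * ‖x‖ ^ (2 * 2))
        / 15 * ((if i = j then (1:ℝ) else 0) * b k + (if i = k then (1:ℝ) else 0) * b j
          + (if k = j then (1:ℝ) else 0) * b i) := by
  have hcoord := EuclideanSpace.hasTemperateGrowth_apply (ι := Fin 3)
  have hnorm := Function.hasTemperateGrowth_norm_sq (EuclideanSpace ℝ (Fin 3))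
  have hw := measurable_occupation θ z
  let g : ℝ → ℝ := fun r => occupation θ z (r ^ 2 / (2 * T)) * (r ^ 2 / T - E)
  let S : EuclideanSpace ℝ (Fin 3) → ℝ := fun x => ∑ m, ∑ n, A m n / T * (x m * x n)
  have hg4 (x : EuclideanSpace ℝ (Fin 3)) : g ‖x‖ * ‖x‖ ^ 4 =
      occupation θ z (‖x‖ ^ 2 / (2 * T)) * ‖x‖ ^ (2 * 3) * T⁻¹
        - E * (occupation θ z (‖x‖ ^ 2 / (2 * T)) * ‖x‖ ^ (2 * 2)) := by
    simp only [g]; ring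
  have hM (m : ℕ) := integrable_occupation_mul_norm_pow hθ hz hT m
  have hgi : Integrable (fun x : EuclideanSpace ℝ (Fin 3) => g ‖x‖ * ‖x‖ ^ 4) := by
    simp_rw [hg4]
    exact ((hM _).mul_const _).sub ((hM _).const_mul _)
  have hgm : Measurable g := by fun_prop
  have hodd : ∫ x : EuclideanSpace ℝ (Fin 3),
      occupation θ z (‖x‖ ^ 2 / (2 * T)) * ((1 + S x) * x i * x j * x k) = 0 :=
    integral_eq_zero_of_odd fun x => by simp [S]
  have hoddi : Integrable fun x : EuclideanSpace ℝ (Fin 3) =>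
      occupation θ z (‖x‖ ^ 2 / (2 * T)) * ((1 + S x) * x i * x j * x k) :=
    integrable_occupation_mul hθ hz hT (by fun_prop)
  have heven (l : Fin 3) : Integrable fun x : EuclideanSpace ℝ (Fin 3) =>
      b l * (g ‖x‖ * (x i * x j * x k * x l)) :=
    (integrable_radial_mul_four hgi hgm i j k l).const_mul _
  have hsplit (x : EuclideanSpace ℝ (Fin 3)) :
      occupation θ z (‖x‖ ^ 2 / (2 * T)) * gradFactor T D E A b x * x i * x j * x k =
        occupation θ z (‖x‖ ^ 2 / (2 * T)) * ((1 + S x) * x i * x j * x k)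
          + ∑ l, b l * (g ‖x‖ * (x i * x j * x k * x l)) := by
    simp only [gradFactor_eq_of_trace_eq_zero hA, S, g, Fin.sum_univ_three]
    ring
  simp_rw [hsplit]
  rw [integral_add hoddi (integrable_finsetSum _ fun l _ => heven l), hodd, zero_add,
    integral_finsetSum _ fun l _ => heven l]
  simp_rw [integral_const_mul, integral_radial_mul_four hgi hgm, hg4]
  rw [integral_sub ((hM _).mul_const _) ((hM _).const_mul _), integral_mul_const,
    integral_const_mul]
  simp only [mul_add, add_mul, add_div, Finset.sum_add_distrib, ite_mul, mul_ite,
    one_mul, zero_mul, mul_one, mul_zero, zero_div, ite_div, Finset.sum_ite_eq, Finset.mem_univ,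
    if_true, Fintype.card_fin, eq_comm (a := k) (b := j)]
  split_ifs <;> norm_num <;> ring

lemma integral_gradFactor_mul_two_mul_sq_norm {θ z T : ℝ} (hθ : θ = -1 ∨ θ = 0 ∨ θ = 1)
    (hz : admissible θ z) (hT : 0 < T) (D E : ℝ) {A : Matrix (Fin 3) (Fin 3) ℝ}
    (hA : A.trace = 0) (hsymm : A.IsSymm) (b : Fin 3 → ℝ) (i j : Fin 3) :
    ∫ x : EuclideanSpace ℝ (Fin 3),
        occupation θ z (‖x‖ ^ 2 / (2 * T)) * gradFactor T D E A b x * x i * x j * ‖x‖ ^ 2 =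
      (if i = j then (1:ℝ) else 0) / 3 *
        (∫ x : EuclideanSpace ℝ (Fin 3), occupation θ z (‖x‖ ^ 2 / (2 * T)) * ‖x‖ ^ (2 * 2))
      + 2 * A i j / (15 * T) *
        ∫ x : EuclideanSpace ℝ (Fin 3), occupation θ z (‖x‖ ^ 2 / (2 * T)) * ‖x‖ ^ (2 * 3) := by
  have hcoord := EuclideanSpace.hasTemperateGrowth_apply (ι := Fin 3)
  have hnorm := Function.hasTemperateGrowth_norm_sq (EuclideanSpace ℝ (Fin 3))
  have hw := measurable_occupation θ z
  let w : ℝ → ℝ := fun r => occupation θ z (r ^ 2 / (2 * T))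
  let g : ℝ → ℝ := fun r => occupation θ z (r ^ 2 / (2 * T)) * r ^ 2
  let Q : EuclideanSpace ℝ (Fin 3) → ℝ := fun x => ∑ l, b l * (x l * (‖x‖ ^ 2 * T⁻¹ - E))
  have hg4 (x : EuclideanSpace ℝ (Fin 3)) : g ‖x‖ * ‖x‖ ^ 4 =
      occupation θ z (‖x‖ ^ 2 / (2 * T)) * ‖x‖ ^ (2 * 3) := by
    simp only [g]; ring
  have hwm : Measurable w := by fun_prop
  have hgm : Measurable g := by fun_prop
  have hM (m : ℕ) := integrable_occupation_mul_norm_pow hθ hz hT m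
  have hwi : Integrable (fun x : EuclideanSpace ℝ (Fin 3) => w ‖x‖ * ‖x‖ ^ 4) := hM 4
  have hgi : Integrable (fun x : EuclideanSpace ℝ (Fin 3) => g ‖x‖ * ‖x‖ ^ 4) := by
    simp_rw [hg4]; exact hM _
  have hodd : ∫ x : EuclideanSpace ℝ (Fin 3),
      occupation θ z (‖x‖ ^ 2 / (2 * T)) * (Q x * x i * x j * ‖x‖ ^ 2) = 0 :=
    integral_eq_zero_of_odd fun x => by simp [Q]
  have hoddi : Integrable fun x : EuclideanSpace ℝ (Fin 3) =>
      occupation θ z (‖x‖ ^ 2 / (2 * T)) * (Q x * x i * x j * ‖x‖ ^ 2) :=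
    integrable_occupation_mul hθ hz hT (by fun_prop)
  have heqi : Integrable fun x : EuclideanSpace ℝ (Fin 3) => w ‖x‖ * (x i * x j * ‖x‖ ^ 2) :=
    integrable_occupation_mul hθ hz hT (by fun_prop)
  have hsumi : Integrable fun x : EuclideanSpace ℝ (Fin 3) =>
      occupation θ z (‖x‖ ^ 2 / (2 * T)) * (Q x * x i * x j * ‖x‖ ^ 2)
        + w ‖x‖ * (x i * x j * ‖x‖ ^ 2) := hoddi.add heqi
  have hstress (m n : Fin 3) : Integrable fun x : EuclideanSpace ℝ (Fin 3) =>
      A m n / T * (g ‖x‖ * (x i * x j * x m * x n)) :=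
    (integrable_radial_mul_four hgi hgm i j m n).const_mul _
  have hsplit (x : EuclideanSpace ℝ (Fin 3)) :
      occupation θ z (‖x‖ ^ 2 / (2 * T)) * gradFactor T D E A b x * x i * x j * ‖x‖ ^ 2 =
        (occupation θ z (‖x‖ ^ 2 / (2 * T)) * (Q x * x i * x j * ‖x‖ ^ 2)
          + w ‖x‖ * (x i * x j * ‖x‖ ^ 2))
          + ∑ m, ∑ n, A m n / T * (g ‖x‖ * (x i * x j * x m * x n)) := by
    simp only [gradFactor_eq_of_trace_eq_zero hA, Q, g, w, Fin.sum_univ_three]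
    ring
  simp_rw [hsplit]
  rw [integral_add hsumi (integrable_finsetSum _ fun m _ =>
      integrable_finsetSum _ fun n _ => hstress m n), integral_add hoddi heqi, hodd, zero_add,
    integral_finsetSum _ fun m _ => integrable_finsetSum _ fun n _ => hstress m n,
    integral_radial_mul_sq_norm_mul_two hwi hwm]
  simp_rw [integral_finsetSum _ fun n _ => hstress _ n, integral_const_mul,
    integral_radial_mul_four hgi hgm, hg4]
  have hs : A j i = A i j := hsymm.apply i j
  simp only [Matrix.trace_fin_three] at hA
  have hdiag : ∑ m, A m m = 0 := by rw [Fin.sum_univ_three]; exact hA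
  have htensor (J : ℝ) : ∑ m, ∑ n, A m n / T *
      (((if i = j then (1:ℝ) else 0) * (if m = n then (1:ℝ) else 0)
        + (if i = m then (1:ℝ) else 0) * (if j = n then (1:ℝ) else 0)
        + (if i = n then (1:ℝ) else 0) * (if j = m then (1:ℝ) else 0)) /
        ((Fintype.card (Fin 3) : ℝ) * ((Fintype.card (Fin 3) : ℝ) + 2)) * J) =
      ((if i = j then (1:ℝ) else 0) * ∑ m, A m m + A i j + A j i) / (15 * T) * J := by
    fin_cases i <;> fin_cases j <;> simp [Fin.sum_univ_three] <;> ring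
  rw [htensor, hdiag, hs]
  simp only [w, Fintype.card_fin]
  push_cast
  ring

/-- The closing moments of the quantum Grad 13-moment ansatz:
`q_{ijk} = (2/5)(δ_{ij}q_k + δ_{ik}q_j + δ_{kj}q_i)` and
`Δ_{ij} = ĉ(2πT)^{3/2}T²𝓛₇(5δ_{ij} + 7(σ_{ij}/p)𝓛₅𝓛₉/𝓛₇²)`. -/
theorem fG13_closing_moments (θ z T c : ℝ)
    (hθ : θ = -1 ∨ θ = 0 ∨ θ = 1) (hz : admissible θ z) (hT : 0 < T) (hc : 0 < c)
    (u : EuclideanSpace ℝ (Fin 3)) (σ : Matrix (Fin 3) (Fin 3) ℝ) (q : Fin 3 → ℝ)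
    (hσ : σ.IsSymm) (htr : σ.trace = 0) :
    (∀ i j k : Fin 3,
      c * (∫ v : EuclideanSpace ℝ (Fin 3),
          fG13 θ z T c u σ q v * (v i - u i) * (v j - u j) * (v k - u k)) =
        (2/5) * ((if i = j then (1:ℝ) else 0) * q k + (if i = k then (1:ℝ) else 0) * q j
          + (if k = j then (1:ℝ) else 0) * q i)) ∧
    (∀ i j : Fin 3,
      c * (∫ v : EuclideanSpace ℝ (Fin 3),
          fG13 θ z T c u σ q v * (v i - u i) * (v j - u j) * ‖v - u‖^2) =
        c * (2 * Real.pi * T) ^ ((3:ℝ)/2) * T^2 * qpolylog θ (7/2) z *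
          (5 * (if i = j then (1:ℝ) else 0)
            + 7 * (σ i j / qpressure θ z T c) *
              (qpolylog θ (5/2) z * qpolylog θ (9/2) z / (qpolylog θ (7/2) z)^2))) := by
  obtain ⟨N, hN⟩ : ∃ N, N = (2 * π * T) ^ ((3:ℝ) / 2) := ⟨_, rfl⟩
  have hNpos : 0 < N := by rw [hN]; positivity
  have hπ : (2 * T) ^ ((3:ℝ) / 2) * π * √π = N := by
    rw [hN, show 2 * π * T = 2 * T * π by ring, Real.mul_rpow (x := 2 * T) (by positivity) Real.pi_pos.le,
      Real.sqrt_eq_rpow, mul_assoc, ← Real.rpow_one_add' Real.pi_pos.le (by norm_num)]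
    norm_num
  have hΓ : Real.Gamma (3 / 2) = √π / 2 := by
    rw [show (3:ℝ) / 2 = 1 / 2 + 1 by norm_num, Real.Gamma_add_one (by norm_num),
      Real.Gamma_one_half_eq]
    ring
  have hM2 : ∫ x : EuclideanSpace ℝ (Fin 3), occupation θ z (‖x‖ ^ 2 / (2 * T)) * ‖x‖ ^ (2 * 2)
      = 15 * T ^ 2 * N * qpolylog θ (7 / 2) z := by
    rw [integral_occupation_mul_norm_pow θ z hT 2, ← hπ, add_comm,
      Real.rpow_add_natCast (by positivity), add_comm, Nat.cast_ofNat,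
      show (2:ℝ) + 3 / 2 = 3 / 2 + 1 + 1 by norm_num, Real.Gamma_add_one (by norm_num),
      Real.Gamma_add_one (by norm_num), hΓ, show (3:ℝ) / 2 + 1 + 1 = 7 / 2 by norm_num]
    ring
  have hM3 : ∫ x : EuclideanSpace ℝ (Fin 3), occupation θ z (‖x‖ ^ 2 / (2 * T)) * ‖x‖ ^ (2 * 3)
      = 105 * T ^ 3 * N * qpolylog θ (9 / 2) z := by
    rw [integral_occupation_mul_norm_pow θ z hT 3, ← hπ, add_comm,
      Real.rpow_add_natCast (by positivity), add_comm, Nat.cast_ofNat,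
      show (3:ℝ) + 3 / 2 = 3 / 2 + 1 + 1 + 1 by norm_num, Real.Gamma_add_one (by norm_num),
      Real.Gamma_add_one (by norm_num), Real.Gamma_add_one (by norm_num), hΓ,
      show (3:ℝ) / 2 + 1 + 1 + 1 = 9 / 2 by norm_num]
    ring
  have hL5 := qpolylog_pos (s := 5 / 2) hθ hz (by norm_num)
  have hL7 := qpolylog_pos (s := 7 / 2) hθ hz (by norm_num)
  have hturan := qpolylog_sq_lt (s := 5 / 2) hθ hz (by norm_num)
  rw [show (5:ℝ) / 2 + 1 = 7 / 2 by norm_num, show (5:ℝ) / 2 + 2 = 9 / 2 by norm_num] at hturan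
  have hp : qpressure θ z T c = c * N * T * qpolylog θ (5 / 2) z := by rw [hN, qpressure]
  have hppos : 0 < qpressure θ z T c := by rw [hp]; positivity
  obtain ⟨B, hB⟩ : ∃ B, B = 7 / 2 * qpolylog θ (9 / 2) z / qpolylog θ (5 / 2) z
      - 5 / 2 * qpolylog θ (7 / 2) z ^ 2 / qpolylog θ (5 / 2) z ^ 2 := ⟨_, rfl⟩
  have hBL : B * qpolylog θ (5 / 2) z ^ 2 = 7 / 2 * (qpolylog θ (5 / 2) z * qpolylog θ (9 / 2) z)
      - 5 / 2 * qpolylog θ (7 / 2) z ^ 2 := by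
    rw [hB]; field_simp
  have hBpos : B ≠ 0 := by
    rintro rfl
    linarith
  set α : ℝ := 1 / (2 * qpressure θ z T c) * (qpolylog θ (5 / 2) z / qpolylog θ (7 / 2) z) with hα
  set D : ℝ := qpolylog θ (5 / 2) z / qpolylog θ (3 / 2) z
  set E : ℝ := 5 * qpolylog θ (7 / 2) z / qpolylog θ (5 / 2) z with hE
  let b : Fin 3 → ℝ := fun i => B⁻¹ * q i / (5 * qpressure θ z T c * T)
  have hA : (α • σ).trace = 0 := by rw [Matrix.trace_smul, htr, smul_zero]
  have hAs : (α • σ).IsSymm := hσ.smul α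
  have hf (v : EuclideanSpace ℝ (Fin 3)) : fG13 θ z T c u σ q v =
      occupation θ z (‖v - u‖ ^ 2 / (2 * T)) * gradFactor T D E (α • σ) b (v - u) := by
    simp only [fG13, occupation, gradFactor, ← hB, ← hE, D, b, Matrix.smul_apply, smul_eq_mul,
      PiLp.sub_apply]
    congr 3
    refine (Finset.sum_congr rfl fun i _ => Finset.sum_congr rfl fun j _ => ?_)
    rw [hα]
    ring
  constructor
  · intro i j k
    simp_rw [hf, ← PiLp.sub_apply]
    rw [integral_sub_right_eq_self (fun x : EuclideanSpace ℝ (Fin 3) =>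
      occupation θ z (‖x‖ ^ 2 / (2 * T)) * gradFactor T D E (α • σ) b x * x i * x j * x k) u,
      integral_gradFactor_mul_three hθ hz hT D E hA b, hM2, hM3]
    have hcoef : c * ((105 * T ^ 3 * N * qpolylog θ (9 / 2) z / T
        - E * (15 * T ^ 2 * N * qpolylog θ (7 / 2) z)) / 15) =
        2 / 5 * (B * (5 * qpressure θ z T c * T)) := by
      rw [hE, hp, hB]
      field_simp
      ring
    have hb (l : Fin 3) : B * (5 * qpressure θ z T c * T) * b l = q l := by
      simp only [b]; field_simp
    rw [← mul_assoc, hcoef, ← hb i, ← hb j, ← hb k]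
    ring
  · intro i j
    simp_rw [hf, ← PiLp.sub_apply]
    rw [integral_sub_right_eq_self (fun x : EuclideanSpace ℝ (Fin 3) =>
      occupation θ z (‖x‖ ^ 2 / (2 * T)) * gradFactor T D E (α • σ) b x * x i * x j * ‖x‖ ^ 2) u,
      integral_gradFactor_mul_two_mul_sq_norm hθ hz hT D E hA hAs b, hM2, hM3, ← hN,
      Matrix.smul_apply, smul_eq_mul, hα]
    field_simp
    ring
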